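/- Let 0 < ϵ < 1/2 and β = n^{1/2−ϵ}. Then with probability tending to 1 as n → ∞, a random 3CNF formula K on n variables with density β satisfies both: (1) e(K) ≥ ϵ·n·(80β)^{−2/(1−ϵ)}; and (2) K is partially matchable. -/

import Mathlib

open scoped Classical

/-- Propositional variables are natural numbers. -/
abbrev Var := ℕ

/-- A literal: a variable with a polarity (`true` = positive occurrence). -/
abbrev Lit := Var × Bool

/-- A clause: a finite set of literals. -/
abbrev Clause := Finset Lit

/-- A CNF formula: a finite collection of clauses. -/
abbrev CNF := Finset Clause

/-- A truth assignment to all variables. -/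
abbrev Assignment := Var → Bool

/-- A clause is proper if it contains no variable together with its negation. -/
def Clause.Proper (C : Clause) : Prop := ∀ v : Var, ¬((v, true) ∈ C ∧ (v, false) ∈ C)

/-- The set of variables occurring in a clause. -/
def Clause.vars (C : Clause) : Finset Var := C.image Prod.fst

/-- The set of variables occurring in a CNF formula. -/
def CNF.vars (K : CNF) : Finset Var := K.sup Clause.vars

/-- Every clause of the CNF is a proper clause. -/
def CNF.Proper (K : CNF) : Prop := ∀ C ∈ K, Clause.Proper C

/-- Evaluation of a literal under an assignment. -/
def Lit.eval (a : Assignment) (l : Lit) : Bool := if l.2 then a l.1 else !(a l.1)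

/-- An assignment satisfies a clause if it makes some literal of it true. -/
def Clause.Sat (a : Assignment) (C : Clause) : Prop := ∃ l ∈ C, Lit.eval a l = true

/-- An assignment satisfies a CNF if it satisfies every clause. -/
def CNF.Sat (a : Assignment) (K : CNF) : Prop := ∀ C ∈ K, Clause.Sat a C

/-- A CNF formula is unsatisfiable. -/
def CNF.Unsat (K : CNF) : Prop := ¬∃ a : Assignment, CNF.Sat a K

/-- A 3CNF: every clause has exactly 3 literals over 3 distinct variables. -/
def Is3CNF (K : CNF) : Prop := ∀ C ∈ K, C.card = 3 ∧ (Clause.vars C).card = 3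

/-- One admissible step in a resolution derivation from the CNF `K`, given the
list `prev` of earlier clauses: `D` is a clause of `K`, or is obtained by
weakening from an earlier clause, or is the resolvent `C ∨ C'` of two earlier
clauses `C ∨ x` and `C' ∨ ¬x` where the variable `x` occurs in neither `C`
nor `C'`. -/
def ResStep (K : CNF) (prev : List Clause) (D : Clause) : Prop :=
  D ∈ K ∨ (∃ E ∈ prev, E ⊆ D) ∨
    (∃ C₁ ∈ prev, ∃ C₂ ∈ prev, ∃ x : Var,
      (x, true) ∈ C₁ ∧ (x, false) ∈ C₂ ∧
      D = C₁.erase (x, true) ∪ C₂.erase (x, false) ∧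
      (x, true) ∉ D ∧ (x, false) ∉ D)

/-- A resolution derivation of the clause `D` from the CNF `K`: a nonempty
sequence of (proper) clauses, each a clause of `K`, a weakening of an earlier
clause, or a resolvent of two earlier clauses, ending with `D`.  Its size is
the length of the list. -/
def IsResDerivation (K : CNF) (L : List Clause) (D : Clause) : Prop :=
  L ≠ [] ∧ L.getLast? = some D ∧
    ∀ i : Fin L.length, Clause.Proper (L.get i) ∧ ResStep K (L.take i.val) (L.get i)

/-- A resolution refutation of `K`: a derivation of the empty clause from `K`. -/
def IsResRefutation (K : CNF) (L : List Clause) : Prop := IsResDerivation K L ∅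

/-- Extend an assignment of the variables X = {0, …, n-1} to all variables
(by `false` elsewhere). -/
def extendAssign {n : ℕ} (a : Fin n → Bool) : Assignment :=
  fun v => if h : v < n then a ⟨v, h⟩ else false

/-- The set of assignments to the n variables X = {0, …, n-1} satisfying `K`
(for `K` with variables among X this is the set of satisfying assignments of `K`). -/
def satSet (n : ℕ) (K : CNF) : Set (Fin n → Bool) := {a | CNF.Sat (extendAssign a) K}

/-- The CNF `A` (over X = {0, …, n-1} together with extension variables) discards the
assignment `a` to X if no extension of `a` to all remaining variables satisfies `A`. -/
def Discards (n : ℕ) (A : CNF) (a : Fin n → Bool) : Prop :=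
  ¬∃ b : Assignment, (∀ i : Fin n, b i.val = a i) ∧ CNF.Sat b A

/-- The set of assignments to X = {0, …, n-1} discarded by `A`. -/
def discardedSet (n : ℕ) (A : CNF) : Set (Fin n → Bool) := {a | Discards n A a}

/-- The set of all clauses with exactly 3 distinct variables among {0, …, n−1}. -/
def threeClauses (n : ℕ) : Finset Clause :=
  (Finset.range n ×ˢ (Finset.univ : Finset Bool)).powerset.filter
    (fun C => C.card = 3 ∧ (Clause.vars C).card = 3)

/-- The sample space of random 3CNFs on n variables with m clauses: tuples of m
clauses, each chosen from the set of all 3-clauses over {0, …, n−1} (each such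
tuple is chosen uniformly, i.e. the m clauses are i.i.d. uniform, with repetitions). -/
noncomputable def sampleSpace (n m : ℕ) : Finset (Fin m → Clause) :=
  Fintype.piFinset fun _ => threeClauses n


/-- The clauses with exactly three literals over three distinct variables from `V`. -/
def threeClausesOver (V : Finset Var) : Finset Clause :=
  (V ×ˢ (Finset.univ : Finset Bool)).powerset.filter
    (fun C => C.card = 3 ∧ (Clause.vars C).card = 3)

lemma threeClausesOver_range (n : ℕ) : threeClausesOver (Finset.range n) = threeClauses n := rfl

lemma mem_threeClausesOver {V : Finset Var} {C : Clause} :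
    C ∈ threeClausesOver V ↔ Clause.vars C ⊆ V ∧ C.card = 3 ∧ (Clause.vars C).card = 3 := by
  have : C ⊆ V ×ˢ (Finset.univ : Finset Bool) ↔ Clause.vars C ⊆ V := by
    simp only [Clause.vars, Finset.subset_iff, Finset.mem_image, Finset.mem_product,
      Finset.mem_univ, and_true]
    exact ⟨fun h x ⟨l, hl, hx⟩ => hx ▸ h hl, fun h l hl => h ⟨l, hl, rfl⟩⟩
  simp only [threeClausesOver, Finset.mem_filter, Finset.mem_powerset, this]

lemma card_filter_vars_eq {V U : Finset Var} (hU : U ∈ V.powersetCard 3) :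
    ((threeClausesOver V).filter fun C => Clause.vars C = U).card = 8 := by
  obtain ⟨hUV, hU3⟩ := Finset.mem_powersetCard.1 hU
  have h8 : U.powerset.card = 8 := by rw [Finset.card_powerset, hU3]; norm_num
  rw [← h8]
  symm
  refine Finset.card_bij (fun P _ => U.image fun x => (x, decide (x ∈ P))) ?_ ?_ ?_
  · intro P _
    have hv : Clause.vars (U.image fun x => (x, decide (x ∈ P))) = U := by
      simp [Clause.vars, Finset.image_image, Function.comp_def]
    rw [Finset.mem_filter, mem_threeClausesOver, hv]
    refine ⟨⟨hUV, ?_, hU3⟩, rfl⟩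
    rw [Finset.card_image_of_injective _ (fun x y h => (Prod.ext_iff.1 h).1), hU3]
  · intro P hP Q hQ h
    rw [Finset.mem_powerset] at hP hQ
    ext x
    have key : ∀ {P Q : Finset Var}, P ⊆ U →
        (U.image fun x => (x, decide (x ∈ P))) = (U.image fun x => (x, decide (x ∈ Q))) →
        x ∈ P → x ∈ Q := by
      intro P Q hP h hx
      have : (x, true) ∈ U.image fun x => (x, decide (x ∈ P)) :=
        Finset.mem_image.2 ⟨x, hP hx, by simp [hx]⟩
      rw [h] at this
      obtain ⟨y, _, hy⟩ := Finset.mem_image.1 this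
      simp only [Prod.mk.injEq, decide_eq_true_eq] at hy
      exact hy.1 ▸ hy.2
    exact ⟨key hP h, key hQ h.symm⟩
  · intro C hC
    rw [Finset.mem_filter, mem_threeClausesOver] at hC
    obtain ⟨⟨_, hC3, hv3⟩, rfl⟩ := hC
    have hinj : Set.InjOn Prod.fst (C : Set Lit) := Finset.card_image_iff.1 (hv3.trans hC3.symm)
    refine ⟨(Clause.vars C).filter fun x => (x, true) ∈ C, by simp, ?_⟩
    ext ⟨x, b⟩
    simp only [Finset.mem_image, Finset.mem_filter, Prod.mk.injEq]
    constructor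
    · rintro ⟨y, hy, rfl, rfl⟩
      obtain ⟨⟨z, c⟩, hz, rfl⟩ := Finset.mem_image.1 hy
      by_cases ht : (z, true) ∈ C
      · simp [ht, hy]
      · cases c
        · simpa [ht] using hz
        · exact absurd hz ht
    · intro hx
      have hxv : x ∈ Clause.vars C := Finset.mem_image.2 ⟨_, hx, rfl⟩
      refine ⟨x, hxv, rfl, ?_⟩
      cases b
      · simp only [hxv, true_and, decide_eq_false_iff_not]
        intro ht
        simpa using hinj hx ht rfl
      · simp [hxv, hx]

lemma card_threeClausesOver (V : Finset Var) :
    (threeClausesOver V).card = V.card.choose 3 * 8 := by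
  rw [Finset.card_eq_sum_card_fiberwise (f := Clause.vars) (t := V.powersetCard 3),
    Finset.sum_congr rfl fun U hU => card_filter_vars_eq hU]
  · simp
  · intro C hC
    have := mem_threeClausesOver.1 hC
    exact Finset.mem_powersetCard.2 ⟨this.1, this.2.2⟩

lemma cast_choose_three (n : ℕ) : ((n.choose 3 : ℕ) : ℝ) = n * (n - 1) * (n - 2) / 6 := by
  induction n with
  | zero => simp
  | succ k ih =>
    rw [Nat.choose_succ_succ' k 2]
    push_cast
    rw [ih, Nat.cast_choose_two]
    ring

lemma choose_three_le {v n : ℕ} (hvn : v ≤ n) (hn : 0 < n) :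
    ((v.choose 3 : ℕ) : ℝ) ≤ (v / n : ℝ) ^ 3 * (n.choose 3 : ℕ) := by
  have hn' : (0 : ℝ) < n := by exact_mod_cast hn
  have hvn' : (v : ℝ) ≤ n := by exact_mod_cast hvn
  rcases lt_or_ge v 3 with hv | hv
  · rw [Nat.choose_eq_zero_of_lt hv]
    simp only [Nat.cast_zero]
    positivity
  have hv' : (3 : ℝ) ≤ v := by exact_mod_cast hv
  rw [cast_choose_three, cast_choose_three, div_pow, div_mul_eq_mul_div, le_div_iff₀ (by positivity)]
  have h1 : ((v : ℝ) - 1) * n ≤ (n - 1) * v := by linarith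
  have h2 : ((v : ℝ) - 2) * n ≤ (n - 2) * v := by linarith
  have h3 := mul_le_mul h1 h2 (mul_nonneg (by linarith) hn'.le)
    (mul_nonneg (by linarith) (by linarith))
  have h4 := mul_le_mul_of_nonneg_left h3 (by positivity : (0 : ℝ) ≤ v * n)
  linarith

/-- The tuples of clauses among which some `s` distinct ones mention at most `v` variables. -/
noncomputable def sparseTuples (n m s v : ℕ) : Finset (Fin m → Clause) :=
  (sampleSpace n m).filter fun f =>
    ∃ K : CNF, K ⊆ Finset.image f Finset.univ ∧ K.card = s ∧ (CNF.vars K).card ≤ v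

lemma sparseTuples_subset {n m s v : ℕ} (hvn : v ≤ n) :
    sparseTuples n m s v ⊆
      ((Finset.univ : Finset (Fin m)).powersetCard s ×ˢ (Finset.range n).powersetCard v).biUnion
        fun p => Fintype.piFinset fun i =>
          if i ∈ p.1 then threeClausesOver p.2 else threeClauses n := by
  intro f hf
  rw [sparseTuples, Finset.mem_filter] at hf
  obtain ⟨hf, K, hK, hKs, hKv⟩ := hf
  rw [sampleSpace, Fintype.mem_piFinset] at hf
  obtain ⟨S, -, hinj, rfl⟩ := Finset.exists_subset_injOn_image_eq_of_surjOn
    (Finset.univ : Finset (Fin m)) K (f := f) (fun C hC => by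
      simpa using Finset.mem_image.1 (hK hC))
  have hS : S.card = s := by rw [← hKs, Finset.card_image_of_injOn hinj]
  have hsub : ∀ i ∈ S, Clause.vars (f i) ⊆ CNF.vars (S.image f) := fun i hi =>
    Finset.le_sup (f := Clause.vars) (Finset.mem_image_of_mem f hi)
  have hrange : CNF.vars (S.image f) ⊆ Finset.range n := by
    refine Finset.sup_le fun C hC => ?_
    obtain ⟨i, -, rfl⟩ := Finset.mem_image.1 hC
    have := hf i
    rw [← threeClausesOver_range] at this
    exact (mem_threeClausesOver.1 this).1
  obtain ⟨V, hV, hVn, hVc⟩ := Finset.exists_subsuperset_card_eq hrange hKv (by simpa using hvn)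
  refine Finset.mem_biUnion.2 ⟨(S, V), ?_, ?_⟩
  · simp [Finset.mem_powersetCard, hS, hVn, hVc]
  · refine Fintype.mem_piFinset.2 fun i => ?_
    by_cases hi : i ∈ S
    · have := hf i
      rw [← threeClausesOver_range, mem_threeClausesOver] at this
      simp only [hi, if_true]
      exact mem_threeClausesOver.2 ⟨(hsub i hi).trans hV, this.2⟩
    · simpa [hi] using hf i

lemma card_sparseTuples_le {n m s v : ℕ} (hvn : v ≤ n) (hn : 0 < n) :
    ((sparseTuples n m s v).card : ℝ) ≤
      m.choose s * n.choose v * (v / n : ℝ) ^ (3 * s) * (sampleSpace n m).card := by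
  have h1 : ((sparseTuples n m s v).card : ℝ) ≤
      ∑ p ∈ (Finset.univ : Finset (Fin m)).powersetCard s ×ˢ (Finset.range n).powersetCard v,
        ((Fintype.piFinset fun i =>
          if i ∈ p.1 then threeClausesOver p.2 else threeClauses n).card : ℝ) := by
    exact_mod_cast (Finset.card_le_card (sparseTuples_subset hvn)).trans Finset.card_biUnion_le
  refine h1.trans ?_
  have h2 : ∀ p ∈ (Finset.univ : Finset (Fin m)).powersetCard s ×ˢ
        (Finset.range n).powersetCard v,
      ((Fintype.piFinset fun i =>
          if i ∈ p.1 then threeClausesOver p.2 else threeClauses n).card : ℝ) ≤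
        (v / n : ℝ) ^ (3 * s) * (sampleSpace n m).card := by
    rintro ⟨S, V⟩ hp
    simp only [Finset.mem_product, Finset.mem_powersetCard, Finset.subset_univ, true_and] at hp
    obtain ⟨hS, -, hV⟩ := hp
    rw [sampleSpace, Fintype.card_piFinset, Fintype.card_piFinset]
    push_cast
    calc (∏ i : Fin m, ((if i ∈ S then threeClausesOver V else threeClauses n).card : ℝ))
        ≤ ∏ i : Fin m, (if i ∈ S then (v / n : ℝ) ^ 3 else 1) * ((threeClauses n).card : ℝ) := by
          refine Finset.prod_le_prod (fun _ _ => Nat.cast_nonneg _) fun i _ => ?_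
          by_cases hi : i ∈ S
          · simp only [hi, if_true]
            rw [← threeClausesOver_range, card_threeClausesOver, card_threeClausesOver, hV,
              Finset.card_range]
            push_cast
            rw [← mul_assoc]
            exact mul_le_mul_of_nonneg_right (choose_three_le hvn hn) (by norm_num)
          · simp [hi]
      _ = (v / n : ℝ) ^ (3 * s) * ∏ _i : Fin m, ((threeClauses n).card : ℝ) := by
          rw [Finset.prod_mul_distrib]
          congr 1
          rw [Finset.prod_ite_mem, Finset.univ_inter, Finset.prod_const, hS, pow_mul]
  refine (Finset.sum_le_card_nsmul _ _ _ h2).trans (le_of_eq ?_)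
  simp only [Finset.card_product, Finset.card_powersetCard, Finset.card_univ, Fintype.card_fin,
    Finset.card_range, nsmul_eq_mul]
  push_cast
  ring

lemma cast_choose_le_exp_mul_div_pow (n k : ℕ) :
    ((n.choose k : ℕ) : ℝ) ≤ Real.exp k * (n / k : ℝ) ^ k := by
  rcases Nat.eq_zero_or_pos k with rfl | hk
  · simp
  have hk' : (0 : ℝ) < k := by exact_mod_cast hk
  calc ((n.choose k : ℕ) : ℝ) ≤ (n : ℝ) ^ k / k.factorial := Nat.choose_le_pow_div k n
    _ = (k : ℝ) ^ k / k.factorial * (n / k : ℝ) ^ k := by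
        rw [div_pow]; field_simp
    _ ≤ Real.exp k * (n / k : ℝ) ^ k :=
        mul_le_mul_of_nonneg_right (Real.pow_div_factorial_le_exp _ hk'.le _) (by positivity)

lemma choose_mul_choose_mul_le {n m s : ℕ} {β c : ℝ} (hn : 0 < n) (hs : 0 < s) (hc1 : 1 ≤ c)
    (hc3 : c ≤ 3) (hcs : c * s ≤ n) (hm : (m : ℝ) ≤ β * n) :
    (m.choose s * n.choose ⌊c * s⌋₊ * ((⌊c * s⌋₊ : ℕ) / n : ℝ) ^ (3 * s) : ℝ) ≤
      (Real.exp (1 + c) * c ^ (3 - c) * (β * (s / n : ℝ) ^ (2 - c))) ^ s := by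
  have hn' : (0 : ℝ) < n := by exact_mod_cast hn
  have hs' : (1 : ℝ) ≤ s := by exact_mod_cast hs
  have hs0 : (0 : ℝ) < s := by linarith
  have hc0 : 0 < c := by linarith
  have hβ : 0 ≤ β := by
    by_contra h
    have : β * n < 0 := mul_neg_of_neg_of_pos (not_le.1 h) hn'
    linarith [(Nat.cast_nonneg m : (0 : ℝ) ≤ m)]
  set v := ⌊c * s⌋₊ with hv
  have hvc : (v : ℝ) ≤ c * s := Nat.floor_le (by positivity)
  have hv1 : 1 ≤ v := Nat.le_floor (by push_cast; nlinarith)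
  have hv' : (0 : ℝ) < v := by exact_mod_cast hv1
  have hv3 : v ≤ 3 * s := by
    have : (v : ℝ) ≤ 3 * s := hvc.trans (by gcongr)
    exact_mod_cast this
  have hA : (m.choose s : ℝ) ≤ (Real.exp 1 * (β * (n / s))) ^ s := by
    refine (cast_choose_le_exp_mul_div_pow m s).trans ?_
    rw [mul_pow, ← Real.exp_nat_mul, mul_one, ← mul_div_assoc]
    gcongr
  have hB : (n.choose v * ((v : ℕ) / n : ℝ) ^ (3 * s) : ℝ) ≤
      (Real.exp c * (c * (s / n)) ^ (3 - c)) ^ s := by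
    calc (n.choose v * ((v : ℕ) / n : ℝ) ^ (3 * s) : ℝ)
        ≤ Real.exp v * (n / v : ℝ) ^ v * ((v : ℕ) / n : ℝ) ^ (3 * s) := by
          gcongr; exact cast_choose_le_exp_mul_div_pow n v
      _ = Real.exp v * (v / n : ℝ) ^ ((3 * s : ℝ) - v) := by
          have : (v / n : ℝ) ^ (3 * s) = (v / n : ℝ) ^ v * (v / n : ℝ) ^ ((3 * s : ℝ) - v) := by
            rw [← Real.rpow_natCast, ← Real.rpow_natCast, ← Real.rpow_add (by positivity)]
            congr 1; push_cast; ring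
          rw [this, mul_assoc, ← mul_assoc ((n / v : ℝ) ^ v), ← mul_pow]
          rw [show (n / v : ℝ) * (v / n) = 1 by field_simp, one_pow, one_mul]
      _ ≤ Real.exp (c * s) * (c * s / n : ℝ) ^ ((3 * s : ℝ) - c * s) := by
          have h3 : (0 : ℝ) ≤ (3 * s : ℝ) - v := by
            have : (v : ℝ) ≤ 3 * s := by exact_mod_cast hv3
            linarith
          gcongr ?_ * ?_
          · exact Real.exp_le_exp.2 hvc
          · calc (v / n : ℝ) ^ ((3 * s : ℝ) - v) ≤ (c * s / n : ℝ) ^ ((3 * s : ℝ) - v) := by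
                  gcongr
              _ ≤ _ := Real.rpow_le_rpow_of_exponent_ge (by positivity)
                  ((div_le_one hn').2 hcs) (by linarith)
      _ = (Real.exp c * (c * (s / n)) ^ (3 - c)) ^ s := by
          rw [mul_pow, ← Real.exp_nat_mul, ← Real.rpow_natCast (_ ^ (3 - c)),
            ← Real.rpow_mul (by positivity), mul_comm c, mul_div_assoc' c]
          congr 2 <;> ring
  calc (m.choose s * n.choose v * ((v : ℕ) / n : ℝ) ^ (3 * s) : ℝ)
      ≤ (Real.exp 1 * (β * (n / s))) ^ s * (Real.exp c * (c * (s / n)) ^ (3 - c)) ^ s := by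
        rw [mul_assoc]; gcongr
    _ = (Real.exp (1 + c) * c ^ (3 - c) * (β * (s / n : ℝ) ^ (2 - c))) ^ s := by
        rw [← mul_pow, Real.exp_add, Real.mul_rpow hc0.le (by positivity),
          show (3 : ℝ) - c = (2 - c) + 1 by ring, Real.rpow_add_one (x := (s / n : ℝ)) (by positivity)]
        congr 1
        field_simp

lemma expansion_base_le {ϵ β x : ℝ} (hϵ0 : 0 < ϵ) (hϵ1 : ϵ < 1 / 2) (hβ : 1 ≤ β) (hx0 : 0 ≤ x)
    (hx : x ≤ 2 * (80 * β) ^ (-(2 : ℝ) / (1 - ϵ))) :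
    Real.exp (1 + (3 + ϵ) / 2) * ((3 + ϵ) / 2) ^ (3 - (3 + ϵ) / 2) *
      (β * x ^ (2 - (3 + ϵ) / 2)) ≤ 19 / 20 := by
  have hβ0 : 0 < β := by linarith
  have h1 : Real.exp (1 + (3 + ϵ) / 2) ≤ 16 := by
    have h : Real.exp (11 / 4) ^ 4 ≤ 16 ^ 4 := by
      rw [← Real.exp_nat_mul]
      calc Real.exp ((4 : ℕ) * (11 / 4)) = Real.exp 1 ^ 11 := by
            rw [← Real.exp_nat_mul]; norm_num
        _ ≤ 2.7182818286 ^ 11 := by gcongr; exact Real.exp_one_lt_d9.le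
        _ ≤ 16 ^ 4 := by norm_num
    calc Real.exp (1 + (3 + ϵ) / 2) ≤ Real.exp (11 / 4) := Real.exp_le_exp.2 (by linarith)
      _ ≤ 16 := le_of_pow_le_pow_left₀ (by norm_num) (by norm_num) h
  have h2 : ((3 + ϵ) / 2) ^ (3 - (3 + ϵ) / 2) ≤ (49 / 16 : ℝ) := by
    calc ((3 + ϵ) / 2) ^ (3 - (3 + ϵ) / 2) ≤ ((3 + ϵ) / 2) ^ (2 : ℝ) :=
          Real.rpow_le_rpow_of_exponent_le (by linarith) (by linarith)
      _ ≤ (7 / 4) ^ (2 : ℝ) := Real.rpow_le_rpow (by linarith) (by linarith) (by norm_num)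
      _ = 49 / 16 := by norm_num
  have h3 : (2 : ℝ) ^ (2 - (3 + ϵ) / 2) ≤ 3 / 2 := by
    calc (2 : ℝ) ^ (2 - (3 + ϵ) / 2) ≤ 2 ^ (1 / 2 : ℝ) :=
          Real.rpow_le_rpow_of_exponent_le (by norm_num) (by linarith)
      _ = √2 := (Real.sqrt_eq_rpow 2).symm
      _ ≤ 3 / 2 := Real.sqrt_le_iff.2 (by norm_num)
  have h4 : β * x ^ (2 - (3 + ϵ) / 2) ≤ 3 / 160 := by
    calc β * x ^ (2 - (3 + ϵ) / 2)
        ≤ β * (2 * (80 * β) ^ (-(2 : ℝ) / (1 - ϵ))) ^ (2 - (3 + ϵ) / 2) := by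
          gcongr; linarith
      _ = β * (2 ^ (2 - (3 + ϵ) / 2) * (80 * β)⁻¹) := by
          rw [Real.mul_rpow (by norm_num) (by positivity), ← Real.rpow_mul (by positivity),
            ← Real.rpow_neg_one (80 * β)]
          congr 3
          have : 1 - ϵ ≠ 0 := by linarith
          field_simp
          ring
      _ = 2 ^ (2 - (3 + ϵ) / 2) / 80 := by field_simp
      _ ≤ 3 / 160 := by linarith
  calc _ ≤ (16 : ℝ) * (49 / 16) * (3 / 160) := by gcongr
    _ ≤ 19 / 20 := by norm_num

lemma rpow_le_inv_sq {ϵ b : ℝ} (hϵ0 : 0 < ϵ) (hϵ1 : ϵ < 1) (hb : 1 ≤ b) :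
    b ^ (-(2 : ℝ) / (1 - ϵ)) ≤ (b ^ 2)⁻¹ := by
  have h : -(2 : ℝ) / (1 - ϵ) ≤ -2 := by
    rw [div_le_iff₀ (by linarith)]; linarith
  calc b ^ (-(2 : ℝ) / (1 - ϵ)) ≤ b ^ (-2 : ℝ) := Real.rpow_le_rpow_of_exponent_le hb h
    _ = (b ^ 2)⁻¹ := by
      rw [Real.rpow_neg (by linarith)]
      norm_num

lemma matching_base_le {β x : ℝ} (hβ : 1 ≤ β) (hx : x ≤ 2 * ((80 * β) ^ 2)⁻¹) :
    Real.exp (1 + 1) * 1 ^ (3 - 1 : ℝ) * (β * x ^ (2 - 1 : ℝ)) ≤ β⁻¹ := by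
  have hβ0 : 0 < β := by linarith
  have h1 : Real.exp (1 + 1) ≤ 9 := by
    rw [Real.exp_add]
    nlinarith [Real.exp_one_lt_three, Real.exp_pos 1]
  rw [Real.one_rpow, show (2 - 1 : ℝ) = 1 by norm_num, Real.rpow_one, mul_one]
  calc Real.exp (1 + 1) * (β * x) ≤ Real.exp (1 + 1) * (β * (2 * ((80 * β) ^ 2)⁻¹)) := by gcongr
    _ ≤ 9 * (β * (2 * ((80 * β) ^ 2)⁻¹)) := by gcongr
    _ = 18 / 6400 * β⁻¹ := by field_simp; norm_num
    _ ≤ β⁻¹ := by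
      have : 0 < β⁻¹ := by positivity
      linarith

lemma sum_card_sparseTuples_le {n m a N : ℕ} {β c q : ℝ} (hn : 0 < n) (ha : 0 < a) (hc1 : 1 ≤ c)
    (hc3 : c ≤ 3) (hm : (m : ℝ) ≤ β * n) (hq0 : 0 ≤ q) (hq1 : q < 1)
    (hN : ∀ s : ℕ, s ≤ N → c * s ≤ n)
    (hq : ∀ s : ℕ, s ≤ N → Real.exp (1 + c) * c ^ (3 - c) * (β * (s / n : ℝ) ^ (2 - c)) ≤ q) :
    ∑ s ∈ Finset.Ico a (N + 1), ((sparseTuples n m s ⌊c * s⌋₊).card : ℝ) ≤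
      q ^ a / (1 - q) * (sampleSpace n m).card := by
  have hβ : 0 ≤ β := by
    by_contra h
    have : β * n < 0 := mul_neg_of_neg_of_pos (not_le.1 h) (by exact_mod_cast hn)
    linarith [(Nat.cast_nonneg m : (0 : ℝ) ≤ m)]
  calc ∑ s ∈ Finset.Ico a (N + 1), ((sparseTuples n m s ⌊c * s⌋₊).card : ℝ)
      ≤ ∑ s ∈ Finset.Ico a (N + 1), q ^ s * ((sampleSpace n m).card : ℝ) := by
        refine Finset.sum_le_sum fun s hs => ?_
        obtain ⟨has, hsN⟩ := Finset.mem_Ico.1 hs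
        have hsN' : s ≤ N := by omega
        refine (card_sparseTuples_le (Nat.floor_le_of_le (hN s hsN')) hn).trans ?_
        gcongr
        refine (choose_mul_choose_mul_le hn (by omega) hc1 hc3 (hN s hsN') hm).trans ?_
        have : 0 ≤ c := by linarith
        exact pow_le_pow_left₀ (by positivity) (hq s hsN') s
    _ = (∑ s ∈ Finset.Ico a (N + 1), q ^ s) * ((sampleSpace n m).card : ℝ) := by
        rw [Finset.sum_mul]
    _ ≤ _ := by
        gcongr
        exact geom_sum_Ico_le_of_lt_one hq0 hq1

/-- The expansion and matchability property of a tuple of clauses, with size threshold `r`. -/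
def GoodTuple (ϵ r : ℝ) {m : ℕ} (f : Fin m → Clause) : Prop :=
  (∀ K' : CNF, K' ⊆ Finset.image f Finset.univ → r ≤ (K'.card : ℝ) → (K'.card : ℝ) ≤ 2 * r →
      ϵ * r ≤ 2 * ((CNF.vars K').card : ℝ) - 3 * (K'.card : ℝ)) ∧
    ∀ K' : CNF, K' ⊆ Finset.image f Finset.univ → (K'.card : ℝ) ≤ 2 * r →
      K'.card ≤ (CNF.vars K').card

lemma filter_not_goodTuple_subset {n m : ℕ} {ϵ r : ℝ} (hϵ0 : 0 < ϵ) :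
    ((sampleSpace n m).filter fun f => ¬ GoodTuple ϵ r f) ⊆
      (Finset.Ico ⌈r⌉₊ (⌊2 * r⌋₊ + 1)).biUnion
          (fun s => sparseTuples n m s ⌊(3 + ϵ) / 2 * (s : ℝ)⌋₊) ∪
        (Finset.Ico 1 (⌊2 * r⌋₊ + 1)).biUnion
          (fun s => sparseTuples n m s ⌊(1 : ℝ) * (s : ℝ)⌋₊) := by
  intro f hf
  obtain ⟨hf, hbad⟩ := Finset.mem_filter.1 hf
  rw [Finset.mem_union, Finset.mem_biUnion, Finset.mem_biUnion]
  rw [GoodTuple, not_and_or] at hbad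
  rcases hbad with h | h
  · push Not at h
    obtain ⟨K, hK, h1, h2, h3⟩ := h
    refine Or.inl ⟨K.card, Finset.mem_Ico.2 ⟨Nat.ceil_le.2 h1, ?_⟩,
      Finset.mem_filter.2 ⟨hf, K, hK, rfl, Nat.le_floor ?_⟩⟩
    · exact Nat.lt_succ_of_le (Nat.le_floor h2)
    · nlinarith
  · push Not at h
    obtain ⟨K, hK, h2, h3⟩ := h
    refine Or.inr ⟨K.card, Finset.mem_Ico.2 ⟨by omega, ?_⟩,
      Finset.mem_filter.2 ⟨hf, K, hK, rfl, ?_⟩⟩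
    · exact Nat.lt_succ_of_le (Nat.le_floor h2)
    · rw [one_mul, Nat.floor_natCast]
      exact h3.le

lemma card_filter_not_goodTuple_le {n m : ℕ} {ϵ β r : ℝ} (hϵ0 : 0 < ϵ) (hϵ1 : ϵ < 1 / 2)
    (hn : 0 < n) (hβ : 1 < β) (hm : (m : ℝ) ≤ β * n)
    (hr : r = n * (80 * β) ^ (-(2 : ℝ) / (1 - ϵ))) :
    (((sampleSpace n m).filter fun f => ¬ GoodTuple ϵ r f).card : ℝ) ≤
      ((19 / 20 : ℝ) ^ ⌈r⌉₊ / (1 - 19 / 20) + β⁻¹ / (1 - β⁻¹)) * (sampleSpace n m).card := by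
  have hn' : (0 : ℝ) < n := by exact_mod_cast hn
  have ht0 : 0 < (80 * β) ^ (-(2 : ℝ) / (1 - ϵ)) := by positivity
  have hr0 : 0 < r := by rw [hr]; positivity
  have ht := rpow_le_inv_sq hϵ0 (by linarith) (by linarith : 1 ≤ 80 * β)
  have hsr : ∀ s : ℕ, s ≤ ⌊2 * r⌋₊ → (s / n : ℝ) ≤ 2 * (80 * β) ^ (-(2 : ℝ) / (1 - ϵ)) := by
    intro s hs
    rw [div_le_iff₀ hn']
    have : (s : ℝ) ≤ 2 * r := (Nat.le_floor_iff (by positivity)).1 hs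
    rw [hr] at this
    linarith
  have hsn : ∀ s : ℕ, s ≤ ⌊2 * r⌋₊ → 2 * (s : ℝ) ≤ n := by
    intro s hs
    have h1 : ((80 * β) ^ 2)⁻¹ ≤ (80 ^ 2 : ℝ)⁻¹ := by gcongr; linarith
    have h2 : (s / n : ℝ) ≤ 1 / 2 := by
      linarith [hsr s hs, (by norm_num : (80 ^ 2 : ℝ)⁻¹ ≤ 1 / 4)]
    rw [div_le_iff₀ hn'] at h2
    linarith
  have hA := sum_card_sparseTuples_le (N := ⌊2 * r⌋₊) (c := (3 + ϵ) / 2) (q := 19 / 20) hn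
    (Nat.ceil_pos.2 hr0) (by linarith) (by linarith) hm (by norm_num) (by norm_num)
    (fun s hs => le_trans (by gcongr; linarith) (hsn s hs))
    (fun s hs => expansion_base_le hϵ0 hϵ1 hβ.le (by positivity) (hsr s hs))
  have hB := sum_card_sparseTuples_le (N := ⌊2 * r⌋₊) (c := 1) (q := β⁻¹) hn one_pos
    le_rfl (by norm_num) hm (by positivity) (inv_lt_one_of_one_lt₀ hβ)
    (fun s hs => le_trans (by gcongr; norm_num) (hsn s hs))
    (fun s hs => matching_base_le hβ.le (by linarith [hsr s hs]))
  rw [pow_one] at hB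
  have hU := (Finset.card_le_card (filter_not_goodTuple_subset (n := n) (m := m) (r := r) hϵ0)).trans
    ((Finset.card_union_le _ _).trans (add_le_add Finset.card_biUnion_le Finset.card_biUnion_le))
  have hU' : (((sampleSpace n m).filter fun f => ¬ GoodTuple ϵ r f).card : ℝ) ≤
      ∑ s ∈ Finset.Ico ⌈r⌉₊ (⌊2 * r⌋₊ + 1),
          ((sparseTuples n m s ⌊(3 + ϵ) / 2 * (s : ℝ)⌋₊).card : ℝ) +
        ∑ s ∈ Finset.Ico 1 (⌊2 * r⌋₊ + 1),
          ((sparseTuples n m s ⌊(1 : ℝ) * (s : ℝ)⌋₊).card : ℝ) := by exact_mod_cast hU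
  rw [add_mul]
  linarith

lemma card_sampleSpace_pos {n m : ℕ} (hn : 3 ≤ n) : 0 < (sampleSpace n m).card := by
  rw [sampleSpace, Fintype.card_piFinset]
  refine Finset.prod_pos fun _ _ => ?_
  rw [← threeClausesOver_range, card_threeClausesOver, Finset.card_range]
  have := Nat.choose_pos hn
  omega

lemma tendsto_expansion_size {ϵ : ℝ} (hϵ0 : 0 < ϵ) (hϵ1 : ϵ < 1 / 2) :
    Filter.Tendsto (fun n : ℕ =>
      (n : ℝ) * (80 * (n : ℝ) ^ ((1 : ℝ) / 2 - ϵ)) ^ (-(2 : ℝ) / (1 - ϵ)))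
      Filter.atTop Filter.atTop := by
  have hpos : 0 < ϵ / (1 - ϵ) := div_pos hϵ0 (by linarith)
  have h : Filter.Tendsto (fun n : ℕ =>
      (80 : ℝ) ^ (-(2 : ℝ) / (1 - ϵ)) * (n : ℝ) ^ (ϵ / (1 - ϵ))) Filter.atTop Filter.atTop :=
    ((tendsto_rpow_atTop hpos).comp tendsto_natCast_atTop_atTop).const_mul_atTop (by positivity)
  refine h.congr' ?_
  filter_upwards [Filter.eventually_gt_atTop 0] with n hn
  have hn' : (0 : ℝ) < n := by exact_mod_cast hn
  rw [Real.mul_rpow (by norm_num) (by positivity), ← Real.rpow_mul hn'.le, mul_left_comm]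
  congr 1
  rw [mul_comm (n : ℝ), ← Real.rpow_add_one hn'.ne']
  congr 1
  have : 1 - ϵ ≠ 0 := by linarith
  field_simp
  ring

/-- with high probability a random 3CNF of density β = n^{1/2−ϵ} has
expansion e(K) ≥ ϵ·n·(80β)^{−2/(1−ϵ)} and is partially matchable. -/
theorem random_3CNF_expansion_and_matchability (ϵ : ℝ) (hϵ0 : 0 < ϵ) (hϵ1 : ϵ < 1 / 2) :
    Filter.Tendsto
      (fun n : ℕ =>
        (((sampleSpace n ⌊(n : ℝ) ^ ((1 : ℝ) / 2 - ϵ) * n⌋₊).filter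
              (fun f : Fin ⌊(n : ℝ) ^ ((1 : ℝ) / 2 - ϵ) * n⌋₊ → Clause =>
                (∀ K' : CNF, K' ⊆ Finset.image f Finset.univ →
                  (n : ℝ) * (80 * (n : ℝ) ^ ((1 : ℝ) / 2 - ϵ)) ^ (-(2 : ℝ) / (1 - ϵ))
                      ≤ (K'.card : ℝ) →
                  (K'.card : ℝ) ≤
                      2 * n * (80 * (n : ℝ) ^ ((1 : ℝ) / 2 - ϵ)) ^ (-(2 : ℝ) / (1 - ϵ)) →
                  ϵ * n * (80 * (n : ℝ) ^ ((1 : ℝ) / 2 - ϵ)) ^ (-(2 : ℝ) / (1 - ϵ))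
                    ≤ 2 * ((CNF.vars K').card : ℝ) - 3 * (K'.card : ℝ)) ∧
                (∀ K' : CNF, K' ⊆ Finset.image f Finset.univ →
                  (K'.card : ℝ) ≤
                      2 * n * (80 * (n : ℝ) ^ ((1 : ℝ) / 2 - ϵ)) ^ (-(2 : ℝ) / (1 - ϵ)) →
                  K'.card ≤ (CNF.vars K').card))).card : ℝ) /
          ((sampleSpace n ⌊(n : ℝ) ^ ((1 : ℝ) / 2 - ϵ) * n⌋₊).card : ℝ))
      Filter.atTop (nhds 1) := by
  set β : ℕ → ℝ := fun n => (n : ℝ) ^ ((1 : ℝ) / 2 - ϵ) with hβ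
  set r : ℕ → ℝ := fun n => (n : ℝ) * (80 * β n) ^ (-(2 : ℝ) / (1 - ϵ)) with hr
  have hβ_top : Filter.Tendsto β Filter.atTop Filter.atTop :=
    (tendsto_rpow_atTop (by linarith)).comp tendsto_natCast_atTop_atTop
  have hr_top : Filter.Tendsto r Filter.atTop Filter.atTop := tendsto_expansion_size hϵ0 hϵ1
  have herr : Filter.Tendsto (fun n => 1 - ((19 / 20 : ℝ) ^ ⌈r n⌉₊ / (1 - 19 / 20) +
      (β n)⁻¹ / (1 - (β n)⁻¹))) Filter.atTop (nhds 1) := by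
    have h1 : Filter.Tendsto (fun n => (19 / 20 : ℝ) ^ ⌈r n⌉₊) Filter.atTop (nhds 0) :=
      (tendsto_pow_atTop_nhds_zero_of_lt_one (by norm_num) (by norm_num)).comp
        (tendsto_nat_ceil_atTop.comp hr_top)
    have h2 : Filter.Tendsto (fun n => (β n)⁻¹) Filter.atTop (nhds 0) :=
      tendsto_inv_atTop_zero.comp hβ_top
    simpa using tendsto_const_nhds.sub
      ((h1.div_const (1 - 19 / 20)).add (h2.div (tendsto_const_nhds.sub h2) (by norm_num)))
  refine tendsto_of_tendsto_of_tendsto_of_le_of_le' herr tendsto_const_nhds ?_ ?_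
  · filter_upwards [Filter.eventually_ge_atTop 3, hβ_top.eventually_gt_atTop 1] with n hn hβn
    have hpos : (0 : ℝ) < (sampleSpace n ⌊β n * n⌋₊).card := by
      exact_mod_cast card_sampleSpace_pos hn
    have hbad := card_filter_not_goodTuple_le (m := ⌊β n * n⌋₊) hϵ0 hϵ1 (by omega) hβn
      (Nat.floor_le (by positivity)) (rfl : r n = _)
    have hsum : (((sampleSpace n ⌊β n * n⌋₊).filter fun f => GoodTuple ϵ (r n) f).card : ℝ) +
        ((sampleSpace n ⌊β n * n⌋₊).filter fun f => ¬ GoodTuple ϵ (r n) f).card =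
          (sampleSpace n ⌊β n * n⌋₊).card := by
      exact_mod_cast Finset.card_filter_add_card_filter_not _
    rw [le_div_iff₀ hpos, sub_mul, one_mul]
    refine (by linarith : _ ≤ (((sampleSpace n ⌊β n * n⌋₊).filter
      fun f => GoodTuple ϵ (r n) f).card : ℝ)).trans (le_of_eq ?_)
    congr 2
    refine Finset.filter_congr fun f _ => ?_
    simp only [GoodTuple, hr, hβ, mul_assoc]
  · exact Filter.Eventually.of_forall fun n =>
      div_le_one_of_le₀ (by exact_mod_cast Finset.card_filter_le _ _) (Nat.cast_nonneg _)
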